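/- Let i ≠ j be indices with M i j = 0 (an ∞-edge). Then for every subset E ⊆ Σ of small roots with α_i ∉ E, the set D' = {α_i} ∪ (σ_i(E) ∩ Σ) does not contain α_j. Consequently, in the geodesic or shortlex automaton, if D' = δ(D, i) is a non-fail state, then the transition δ(D', j) is defined and δ(D', j) ≠ D'. -/

import Mathlib

open scoped BigOperators

/-- The simple root `α_i`, the `i`-th standard basis vector of `ℝ^n`. -/
noncomputable def simpleRoot {n : ℕ} (i : Fin n) : Fin n → ℝ := Pi.single i 1

/-- The symmetric bilinear form `B` associated to the Coxeter matrix `M`, determined by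
`B(α_i, α_j) = -cos (π / M i j)` when `M i j ≠ 0` and `B(α_i, α_j) = -1` when
`M i j = 0` (the label `∞`). -/
noncomputable def bform {n : ℕ} (M : CoxeterMatrix (Fin n)) (u v : Fin n → ℝ) : ℝ :=
  ∑ i, ∑ j, u i * (if M i j = 0 then -1 else -Real.cos (Real.pi / (M i j))) * v j

/-- The simple reflection `σ_i(v) = v - 2 B(v, α_i) α_i`. -/
noncomputable def simpleRefl {n : ℕ} (M : CoxeterMatrix (Fin n)) (i : Fin n)
    (v : Fin n → ℝ) : Fin n → ℝ :=
  v - (2 * bform M v (simpleRoot i)) • simpleRoot i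

/-- The set `Σ` of small roots of `M`: the smallest set of vectors containing the simple
roots `α_1, …, α_n` and such that whenever `v ∈ Σ` and `-1 < B(v, α_i) < 0`, also
`σ_i(v) ∈ Σ`. -/
inductive IsSmallRoot {n : ℕ} (M : CoxeterMatrix (Fin n)) : (Fin n → ℝ) → Prop
  | simple (i : Fin n) : IsSmallRoot M (simpleRoot i)
  | reflect {v : Fin n → ℝ} (i : Fin n) : IsSmallRoot M v →
      -1 < bform M v (simpleRoot i) → bform M v (simpleRoot i) < 0 →
      IsSmallRoot M (simpleRefl M i v)

/-- The transition function of the geodesic automaton `Geo` (defined when `α_i ∉ D`):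
`δ(D, i) = {α_i} ∪ (σ_i(D) ∩ Σ)`. -/
noncomputable def stepGeo {n : ℕ} (M : CoxeterMatrix (Fin n)) (D : Set (Fin n → ℝ))
    (i : Fin n) : Set (Fin n → ℝ) :=
  insert (simpleRoot i) (simpleRefl M i '' D ∩ {v | IsSmallRoot M v})

/-- The transition function of the shortlex automaton `ShortLex` (defined when `α_i ∉ D`):
`δ(D, i) = {α_i} ∪ ((σ_i(D) ∪ {σ_i(α_l) : l < i}) ∩ Σ)`. -/
noncomputable def stepSL {n : ℕ} (M : CoxeterMatrix (Fin n)) (D : Set (Fin n → ℝ))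
    (i : Fin n) : Set (Fin n → ℝ) :=
  insert (simpleRoot i)
    ((simpleRefl M i '' D ∪ simpleRefl M i '' {v | ∃ l : Fin n, l < i ∧ v = simpleRoot l})
      ∩ {v | IsSmallRoot M v})

theorem bform_sub_left {n : ℕ} (M : CoxeterMatrix (Fin n)) (u v w : Fin n → ℝ) :
    bform M (u - v) w = bform M u w - bform M v w := by
  simp only [bform, ← Finset.sum_sub_distrib, Pi.sub_apply, sub_mul]

theorem bform_smul_left {n : ℕ} (M : CoxeterMatrix (Fin n)) (c : ℝ) (v w : Fin n → ℝ) :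
    bform M (c • v) w = c * bform M v w := by
  simp only [bform, Finset.mul_sum, Pi.smul_apply, smul_eq_mul, mul_assoc]

theorem bform_simpleRoot {n : ℕ} (M : CoxeterMatrix (Fin n)) (k l : Fin n) :
    bform M (simpleRoot k) (simpleRoot l) =
      if M k l = 0 then -1 else -Real.cos (Real.pi / (M k l)) := by
  unfold bform simpleRoot
  rw [Finset.sum_eq_single k (by intro b _ hb; simp [hb]) (by simp),
    Finset.sum_eq_single l (by intro b _ hb; simp [hb]) (by simp)]
  simp

theorem bform_simpleRoot_self {n : ℕ} (M : CoxeterMatrix (Fin n)) (k : Fin n) :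
    bform M (simpleRoot k) (simpleRoot k) = 1 := by
  simp [bform_simpleRoot]

theorem bform_simpleRoot_nonpos {n : ℕ} (M : CoxeterMatrix (Fin n)) {k l : Fin n}
    (hkl : k ≠ l) : bform M (simpleRoot k) (simpleRoot l) ≤ 0 := by
  rw [bform_simpleRoot]
  split_ifs with h
  · norm_num
  · have hm : (2 : ℝ) ≤ M k l := by
      have := M.off_diagonal k l hkl
      exact_mod_cast (by omega : 2 ≤ M k l)
    have hle : Real.pi / M k l ≤ Real.pi / 2 :=
      div_le_div_of_nonneg_left Real.pi_pos.le two_pos hm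
    have hnn : 0 ≤ Real.pi / M k l := by positivity
    linarith [Real.cos_nonneg_of_neg_pi_div_two_le_of_le (by linarith [Real.pi_pos]) hle]

theorem bform_simpleRefl_simpleRoot {n : ℕ} (M : CoxeterMatrix (Fin n)) (k : Fin n)
    (v : Fin n → ℝ) :
    bform M (simpleRefl M k v) (simpleRoot k) = -bform M v (simpleRoot k) := by
  rw [simpleRefl, bform_sub_left, bform_smul_left, bform_simpleRoot_self]
  ring

theorem simpleRefl_simpleRefl {n : ℕ} (M : CoxeterMatrix (Fin n)) (k : Fin n)
    (v : Fin n → ℝ) : simpleRefl M k (simpleRefl M k v) = v := by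
  rw [simpleRefl, bform_simpleRefl_simpleRoot, simpleRefl]
  module

theorem IsSmallRoot.eq_simpleRoot_or_exists_bform {n : ℕ} {M : CoxeterMatrix (Fin n)}
    {v : Fin n → ℝ} (hv : IsSmallRoot M v) :
    (∃ k, v = simpleRoot k) ∨
      ∃ k, 0 < bform M v (simpleRoot k) ∧ bform M v (simpleRoot k) < 1 := by
  cases hv with
  | simple k => exact .inl ⟨k, rfl⟩
  | reflect k _ h₁ h₂ =>
    refine .inr ⟨k, ?_⟩
    rw [bform_simpleRefl_simpleRoot]
    constructor <;> linarith

/-- Across an `∞`-edge, the root `σ_i(α_j) = α_j + 2 α_i` is not small. -/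
theorem not_isSmallRoot_simpleRefl_simpleRoot {n : ℕ} (M : CoxeterMatrix (Fin n))
    {i j : Fin n} (hij : i ≠ j) (hMij : M i j = 0) :
    ¬ IsSmallRoot M (simpleRefl M i (simpleRoot j)) := by
  have hji : bform M (simpleRoot j) (simpleRoot i) = -1 := by
    rw [bform_simpleRoot, M.symmetric, if_pos hMij]
  have hB (k : Fin n) : bform M (simpleRefl M i (simpleRoot j)) (simpleRoot k) =
      bform M (simpleRoot j) (simpleRoot k) + 2 * bform M (simpleRoot i) (simpleRoot k) := by
    rw [simpleRefl, bform_sub_left, bform_smul_left, hji]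
    ring
  intro h
  obtain ⟨k, hk⟩ | ⟨k, hpos, hlt⟩ := h.eq_simpleRoot_or_exists_bform
  · have hki := congrFun hk i
    rw [simpleRefl, hji] at hki
    by_cases hik : i = k <;> simp [simpleRoot, hij, hik] at hki
    subst hik
    simp [hij] at hki
  · rw [hB] at hpos hlt
    by_cases hik : i = k
    · subst hik
      rw [hji, bform_simpleRoot_self] at hlt
      norm_num at hlt
    · have hi := bform_simpleRoot_nonpos M hik
      by_cases hjk : j = k
      · subst hjk
        rw [bform_simpleRoot_self, bform_simpleRoot, if_pos hMij] at hpos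
        norm_num at hpos
      · linarith [bform_simpleRoot_nonpos M hjk]

theorem simpleRoot_injective {n : ℕ} : Function.Injective (simpleRoot (n := n)) := by
  intro k l h
  by_contra hkl
  simpa [simpleRoot, hkl] using congrFun h k

theorem simpleRoot_notMem_insert_image_simpleRefl {n : ℕ} (M : CoxeterMatrix (Fin n))
    {i j : Fin n} (hij : i ≠ j) (hMij : M i j = 0) {E : Set (Fin n → ℝ)}
    (hE : ∀ v ∈ E, IsSmallRoot M v) :
    simpleRoot j ∉ insert (simpleRoot i) (simpleRefl M i '' E ∩ {v | IsSmallRoot M v}) := by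
  rintro (h | ⟨⟨v, hv, hvj⟩, -⟩)
  · exact hij (simpleRoot_injective h).symm
  · apply not_isSmallRoot_simpleRefl_simpleRoot M hij hMij
    rw [← hvj, simpleRefl_simpleRefl]
    exact hE v hv

/-- **Hiking lemma.** Let `i ≠ j` with `M i j = 0` (an `∞`-edge). Then for any `E ⊆ Σ` with
`α_i ∉ E`, the set `D' = {α_i} ∪ (σ_i(E) ∩ Σ)` does not contain `α_j`. Consequently, in the
geodesic or shortlex automaton, if `D' = δ(D, i)` is a non-fail state then the transition
`δ(D', j)` is defined and differs from `D'`. -/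
theorem hiking_lemma {n : ℕ} (hn : 3 ≤ n) (M : CoxeterMatrix (Fin n)) (i j : Fin n)
    (hij : i ≠ j) (hMij : M i j = 0) :
    (∀ E : Set (Fin n → ℝ), (∀ v ∈ E, IsSmallRoot M v) → simpleRoot i ∉ E →
      simpleRoot j ∉ insert (simpleRoot i) (simpleRefl M i '' E ∩ {v | IsSmallRoot M v})) ∧
    (∀ D : Set (Fin n → ℝ), (∀ v ∈ D, IsSmallRoot M v) → simpleRoot i ∉ D →
      (simpleRoot j ∉ stepGeo M D i ∧ stepGeo M (stepGeo M D i) j ≠ stepGeo M D i) ∧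
      (simpleRoot j ∉ stepSL M D i ∧ stepSL M (stepSL M D i) j ≠ stepSL M D i)) := by
  refine ⟨fun E hE _ => simpleRoot_notMem_insert_image_simpleRefl M hij hMij hE,
    fun D hD _ => ?_⟩
  have hgeo : simpleRoot j ∉ stepGeo M D i :=
    simpleRoot_notMem_insert_image_simpleRefl M hij hMij hD
  have hSL : simpleRoot j ∉ stepSL M D i := by
    rw [stepSL, ← Set.image_union]
    refine simpleRoot_notMem_insert_image_simpleRefl M hij hMij ?_
    rintro v (hv | ⟨l, -, rfl⟩)
    · exact hD v hv
    · exact .simple l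
  exact ⟨⟨hgeo, fun h => hgeo (h ▸ Set.mem_insert _ _)⟩,
    ⟨hSL, fun h => hSL (h ▸ Set.mem_insert _ _)⟩⟩
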